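/- For every real θ with 0 < |θ| < π, both series S₁(θ) = ∑_{ℓ=1}^{∞} [4·(−1)^{ℓ+1}·(2ℓ−2)!/(4^ℓ·((ℓ−1)!)²)] · (e^{(2ℓ−1)iθ} − 1)/((2ℓ−1)iθ) and S₂(θ) = ∑_{ℓ=1}^{∞} [(−1)^{ℓ+1}·(2ℓ)!/(4^ℓ·(ℓ!)²)] · (e^{−2ℓiθ} − 1)/(2ℓiθ) converge absolutely, and S₁(θ) − S₂(θ) = (1/(iθ)) · Log( (e^{iθ} + √(1 + e^{2iθ})) / (1 + √(1 + e^{−2iθ})) ), where Log and √ denote the principal branches of the complex logarithm and square root. -/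

import Mathlib

open Complex

/-- The `ℓ`-th term (for `ℓ ≥ 1`) of the series `S₁(θ)`: the infinite-order zigzag
coefficient `Z_∞^{2ℓ−1} = 4·(−1)^{ℓ+1}·(2ℓ−2)!/(4^ℓ·((ℓ−1)!)²)` times
`(e^{(2ℓ−1)iθ} − 1)/((2ℓ−1)iθ)`. -/
noncomputable def zigzagOddTerm (θ : ℝ) (ℓ : ℕ) : ℂ :=
  (4 * (-1) ^ (ℓ + 1) * (((2 * ℓ - 2).factorial : ℕ) : ℂ) /
      (4 ^ ℓ * (((ℓ - 1).factorial : ℕ) : ℂ) ^ 2)) *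
    (Complex.exp (((2 * ℓ - 1 : ℕ) : ℂ) * Complex.I * θ) - 1) /
      (((2 * ℓ - 1 : ℕ) : ℂ) * Complex.I * θ)

/-- The `ℓ`-th term (for `ℓ ≥ 1`) of the series `S₂(θ)`: the infinite-order zigzag
coefficient `Z_∞^{2ℓ} = (−1)^{ℓ+1}·(2ℓ)!/(4^ℓ·(ℓ!)²)` times
`(e^{−2ℓiθ} − 1)/(2ℓiθ)`. -/
noncomputable def zigzagEvenTerm (θ : ℝ) (ℓ : ℕ) : ℂ :=
  ((-1) ^ (ℓ + 1) * (((2 * ℓ).factorial : ℕ) : ℂ) / (4 ^ ℓ * ((ℓ.factorial : ℕ) : ℂ) ^ 2)) *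
    (Complex.exp (-((2 * ℓ : ℕ) : ℂ) * Complex.I * θ) - 1) /
      (((2 * ℓ : ℕ) : ℂ) * Complex.I * θ)

open Metric

/-- A lacunary power series with absolutely summable coefficients whose termwise derivative sums
to `g'` on the open unit disc sums to `g` on the closed unit disc. -/
theorem hasSum_mul_pow_of_hasDerivAt {c : ℕ → ℂ} {k : ℕ → ℕ} {g g' : ℂ → ℂ}
    (hk : ∀ n, k n ≠ 0) (hc : Summable fun n => ‖c n‖)
    (hg : ContinuousOn g (closedBall 0 1)) (hg0 : g 0 = 0)
    (hg' : ∀ z ∈ ball (0 : ℂ) 1, HasDerivAt g (g' z) z)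
    (hsum : ∀ z ∈ ball (0 : ℂ) 1, HasSum (fun n => c n * (k n * z ^ (k n - 1))) (g' z))
    {z : ℂ} (hz : z ∈ closedBall (0 : ℂ) 1) : HasSum (fun n => c n * z ^ k n) (g z) := by
  have hle : ∀ n, ∀ w ∈ closedBall (0 : ℂ) 1, ‖c n * w ^ k n‖ ≤ ‖c n‖ := fun n w hw => by
    rw [norm_mul, norm_pow]
    exact mul_le_of_le_one_right (norm_nonneg _)
      (pow_le_one₀ (norm_nonneg _) (mem_closedBall_zero_iff.1 hw))
  have hF : ∀ w ∈ closedBall (0 : ℂ) 1, Summable fun n => c n * w ^ k n := fun w hw =>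
    .of_norm_bounded hc fun n => hle n w hw
  have hFc : ContinuousOn (fun w => ∑' n, c n * w ^ k n) (closedBall 0 1) :=
    continuousOn_tsum (fun n => by fun_prop) hc hle
  have hF' : ∀ w ∈ ball (0 : ℂ) 1, HasDerivAt (fun w => ∑' n, c n * w ^ k n) (g' w) w := by
    intro w hw
    obtain ⟨r, hwr, hr⟩ := exists_between (mem_ball_zero_iff.1 hw)
    have hr0 : 0 < r := (norm_nonneg w).trans_lt hwr
    have hrs := (hsum r (by simpa [abs_of_pos hr0] using hr)).summable.norm
    rw [← (hsum w hw).tsum_eq]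
    refine hasDerivAt_tsum_of_isPreconnected (t := ball 0 r) (y₀ := 0) hrs isOpen_ball
      (convex_ball 0 r).isPreconnected (fun n y _ => (hasDerivAt_pow (k n) y).const_mul (c n))
      (fun n y hy => ?_) (mem_ball_self hr0) (hF 0 (by simp)) (mem_ball_zero_iff.2 hwr)
    simp only [norm_mul, norm_pow, norm_real, Real.norm_eq_abs, abs_of_pos hr0]
    gcongr
    exact (mem_ball_zero_iff.1 hy).le
  have heq : Set.EqOn (fun w => ∑' n, c n * w ^ k n) g (ball 0 1) :=
    isOpen_ball.eqOn_of_deriv_eq (convex_ball (0 : ℂ) 1).isPreconnected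
      (fun w hw => (hF' w hw).differentiableAt.differentiableWithinAt)
      (fun w hw => (hg' w hw).differentiableAt.differentiableWithinAt)
      (fun w hw => (hF' w hw).deriv.trans (hg' w hw).deriv.symm)
      (mem_ball_self one_pos) (by simp [hg0, hk])
  have := heq.of_subset_closure hFc hg ball_subset_closedBall
    (closure_ball (0 : ℂ) one_ne_zero).ge hz
  exact this ▸ (hF z hz).hasSum

/-- The normalised central binomial coefficient `(2n)! / (4ⁿ (n!)²)`. -/
noncomputable def scaledCentralBinom (n : ℕ) : ℝ := n.centralBinom / 4 ^ n

theorem scaledCentralBinom_nonneg (n : ℕ) : 0 ≤ scaledCentralBinom n := by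
  unfold scaledCentralBinom; positivity

theorem scaledCentralBinom_succ (n : ℕ) :
    scaledCentralBinom (n + 1) = scaledCentralBinom n * ((2 * n + 1) / (2 * n + 2)) := by
  have h : ((n : ℝ) + 1) * (n + 1).centralBinom = 2 * (2 * n + 1) * n.centralBinom := by
    exact_mod_cast Nat.succ_mul_centralBinom_succ n
  unfold scaledCentralBinom
  field_simp
  linear_combination 2 * 4 ^ n * h

theorem scaledCentralBinom_eq_factorial (n : ℕ) :
    scaledCentralBinom n = (2 * n).factorial / (4 ^ n * (n.factorial : ℝ) ^ 2) := by
  rw [scaledCentralBinom, Nat.centralBinom_eq_two_mul_choose,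
    Nat.cast_choose ℝ (by omega : n ≤ 2 * n), show 2 * n - n = n by omega]
  field_simp

theorem summable_scaledCentralBinom_div :
    Summable fun n : ℕ => scaledCentralBinom n / (2 * n + 2) := by
  refine summable_of_sum_range_le (c := 1)
    (fun n => div_nonneg (scaledCentralBinom_nonneg n) (by positivity)) fun n => ?_
  have h : ∀ i : ℕ, scaledCentralBinom i / (2 * i + 2) =
      scaledCentralBinom i - scaledCentralBinom (i + 1) := fun i => by
    rw [scaledCentralBinom_succ]; field_simp; ring
  simp_rw [h, Finset.sum_range_sub']
  have : scaledCentralBinom 0 = 1 := by simp [scaledCentralBinom]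
  linarith [scaledCentralBinom_nonneg n]

theorem choose_neg_half (n : ℕ) :
    Ring.choose (-(1 / 2) : ℂ) n = (-1) ^ n * (scaledCentralBinom n : ℂ) := by
  induction n with
  | zero => simp [scaledCentralBinom]
  | succ n ih =>
    rw [Ring.choose_eq_smul] at ih ⊢
    have hn : (n.factorial : ℂ) ≠ 0 := by exact_mod_cast n.factorial_ne_zero
    have hn1 : (n : ℂ) + 1 ≠ 0 := by exact_mod_cast n.succ_ne_zero
    rw [smul_eq_mul, inv_mul_eq_iff_eq_mul₀ hn] at ih
    rw [descPochhammer_succ_right, Polynomial.smeval_mul, scaledCentralBinom_succ, ih,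
      Polynomial.smeval_sub, Polynomial.smeval_X, Polynomial.smeval_natCast, smul_eq_mul,
      Nat.factorial_succ]
    have h2 : (2 * n + 2 : ℂ) ≠ 0 := by rw [← mul_add_one]; exact mul_ne_zero two_ne_zero hn1
    push_cast
    simp
    field_simp
    ring

theorem hasSum_one_add_cpow_neg_half {z : ℂ} (hz : ‖z‖ < 1) :
    HasSum (fun n => (-1) ^ n * (scaledCentralBinom n : ℂ) * z ^ n)
      (((1 + z) ^ (1 / 2 : ℂ))⁻¹) := by
  have := (one_add_cpow_hasFPowerSeriesOnBall_zero (a := -(1 / 2))).hasSum (y := z)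
    (by simpa [enorm_eq_nnnorm, ← NNReal.coe_lt_coe] using hz)
  simp only [binomialSeries_apply, choose_neg_half, cpow_neg, List.ofFn_const,
    List.prod_replicate, smul_eq_mul, zero_add] at this
  exact this

theorem one_add_cpow_half_sq (z : ℂ) : ((1 + z) ^ (1 / 2 : ℂ)) ^ 2 = 1 + z := by
  rw [one_div, cpow_ofNat_inv_pow]

theorem re_cpow_half_nonneg (z : ℂ) : 0 ≤ (z ^ (1 / 2 : ℂ)).re := by
  rcases eq_or_ne z 0 with rfl | hz
  · simp
  rw [cpow_def_of_ne_zero hz, exp_re]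
  have him : (log z * (1 / 2)).im = arg z / 2 := by
    rw [show (1 / 2 : ℂ) = ((1 / 2 : ℝ) : ℂ) by push_cast; rfl, im_mul_ofReal, log_im]; ring
  rw [him]
  exact mul_nonneg (Real.exp_pos _).le (Real.cos_nonneg_of_mem_Icc
    ⟨by linarith [neg_pi_lt_arg z], by linarith [arg_le_pi z]⟩)

theorem continuousOn_one_add_cpow_half :
    ContinuousOn (fun z : ℂ => (1 + z) ^ (1 / 2 : ℂ)) (closedBall 0 1) := by
  intro z hz
  have hre : 0 ≤ (1 + z).re := by
    have := (abs_le.1 ((abs_re_le_norm z).trans (mem_closedBall_zero_iff.1 hz))).1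
    simp only [add_re, one_re]; linarith
  exact (ContinuousAt.comp (f := fun z : ℂ => 1 + z)
    (continuousAt_cpow_const_of_re_pos (.inl hre) (by norm_num))
    (by fun_prop)).continuousWithinAt

theorem one_add_cpow_half_ne_zero {z : ℂ} (hz : ‖z‖ < 1) : (1 + z) ^ (1 / 2 : ℂ) ≠ 0 := by
  intro h
  have h1 := one_add_cpow_half_sq z
  rw [h, zero_pow two_ne_zero] at h1
  rw [← neg_eq_of_add_eq_zero_right h1.symm] at hz
  simp at hz

theorem hasDerivAt_one_add_cpow_half {z : ℂ} (hz : ‖z‖ < 1) :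
    HasDerivAt (fun z : ℂ => (1 + z) ^ (1 / 2 : ℂ)) (1 / 2 * ((1 + z) ^ (1 / 2 : ℂ))⁻¹) z := by
  have h := ((hasDerivAt_id z).const_add 1).cpow_const (c := 1 / 2)
    (mem_slitPlane_of_norm_lt_one hz)
  rw [show (1 / 2 - 1 : ℂ) = -(1 / 2) by norm_num, cpow_neg, mul_one] at h
  exact h

theorem re_add_cpow_half_nonneg (z : ℂ) : 0 ≤ (z + (1 + z ^ 2) ^ (1 / 2 : ℂ)).re := by
  have hs := re_cpow_half_nonneg (1 + z ^ 2)
  have hsq := one_add_cpow_half_sq (z ^ 2)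
  set s := (1 + z ^ 2) ^ (1 / 2 : ℂ)
  have huv : s - z = (z + s)⁻¹ := eq_inv_of_mul_eq_one_left (by linear_combination hsq)
  by_contra! hneg
  have hv : (s - z).re ≤ 0 := by
    rw [huv, inv_re]; exact div_nonpos_of_nonpos_of_nonneg hneg.le (normSq_nonneg _)
  simp only [sub_re, add_re] at hv hneg
  linarith

theorem add_cpow_half_ne_zero (z : ℂ) : z + (1 + z ^ 2) ^ (1 / 2 : ℂ) ≠ 0 := by
  intro h
  have hsq := one_add_cpow_half_sq (z ^ 2)
  exact one_ne_zero (α := ℂ)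
    (by linear_combination ((1 + z ^ 2) ^ (1 / 2 : ℂ) - z) * h - hsq)

theorem mem_slitPlane_of_re_nonneg {z : ℂ} (h : 0 ≤ z.re) (hz : z ≠ 0) : z ∈ slitPlane := by
  by_contra h'
  simp only [mem_slitPlane_iff, not_or, not_lt, not_not] at h'
  exact hz (Complex.ext (le_antisymm h'.1 h) h'.2)

theorem re_one_add_cpow_half_pos (z : ℂ) : 0 < (1 + z ^ (1 / 2 : ℂ)).re := by
  simpa using add_pos_of_pos_of_nonneg one_pos (re_cpow_half_nonneg z)

theorem hasSum_log_add_cpow_half {z : ℂ} (hz : ‖z‖ ≤ 1) :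
    HasSum (fun n : ℕ => (-1) ^ n * (scaledCentralBinom n : ℂ) / (2 * n + 1) * z ^ (2 * n + 1))
      (log (z + (1 + z ^ 2) ^ (1 / 2 : ℂ))) := by
  have hmem : ∀ w : ℂ, w + (1 + w ^ 2) ^ (1 / 2 : ℂ) ∈ slitPlane := fun w =>
    mem_slitPlane_of_re_nonneg (re_add_cpow_half_nonneg w) (add_cpow_half_ne_zero w)
  have hsq : ∀ w : ℂ, ‖w‖ < 1 → ‖w ^ 2‖ < 1 := fun w hw => by
    rw [norm_pow]; exact pow_lt_one₀ (norm_nonneg w) hw two_ne_zero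
  refine hasSum_mul_pow_of_hasDerivAt (g := fun z => log (z + (1 + z ^ 2) ^ (1 / 2 : ℂ)))
    (g' := fun z => ((1 + z ^ 2) ^ (1 / 2 : ℂ))⁻¹)
    (fun n => by omega) ?_ ?_ (by simp) (fun w hw => ?_) (fun w hw => ?_)
    (mem_closedBall_zero_iff.2 hz)
  · refine .of_nonneg_of_le (fun n => norm_nonneg _) (fun n => ?_)
      (summable_scaledCentralBinom_div.mul_left 2)
    have h1 : ‖(2 * n + 1 : ℂ)‖ = 2 * n + 1 := by
      exact_mod_cast Complex.norm_natCast (2 * n + 1)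
    rw [norm_div, norm_mul, norm_pow, norm_neg, norm_one, one_pow, one_mul, h1, norm_real,
      Real.norm_of_nonneg (scaledCentralBinom_nonneg n), ← mul_div_assoc,
      div_le_div_iff₀ (by positivity) (by positivity)]
    nlinarith [scaledCentralBinom_nonneg n, mul_nonneg (scaledCentralBinom_nonneg n) n.cast_nonneg]
  · refine ContinuousOn.clog (continuousOn_id.add (continuousOn_one_add_cpow_half.comp
      (f := fun w : ℂ => w ^ 2) (by fun_prop) fun w hw => ?_)) fun w _ => hmem w
    rw [mem_closedBall_zero_iff] at hw ⊢
    rw [norm_pow]; exact pow_le_one₀ (norm_nonneg w) hw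
  · rw [mem_ball_zero_iff] at hw
    have h : HasDerivAt (fun w : ℂ => w + (1 + w ^ 2) ^ (1 / 2 : ℂ)) _ w :=
      (hasDerivAt_id w).add (HasDerivAt.comp (h₂ := fun z : ℂ => (1 + z) ^ (1 / 2 : ℂ)) w
        (hasDerivAt_one_add_cpow_half (hsq w hw)) (hasDerivAt_pow 2 w))
    refine (h.clog (hmem w)).congr_deriv ?_
    have h1 := one_add_cpow_half_ne_zero (hsq w hw)
    have h2 := add_cpow_half_ne_zero w
    field_simp
    push_cast
    ring
  · rw [mem_ball_zero_iff] at hw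
    refine (hasSum_one_add_cpow_neg_half (hsq w hw)).congr_fun fun n => ?_
    have h1 : (2 * n + 1 : ℂ) ≠ 0 := by exact_mod_cast (2 * n).succ_ne_zero
    push_cast
    rw [pow_mul]
    field_simp

theorem hasSum_log_one_add_cpow_half {z : ℂ} (hz : ‖z‖ ≤ 1) :
    HasSum (fun n : ℕ => (-1) ^ n * (scaledCentralBinom (n + 1) : ℂ) / (2 * n + 2) * z ^ (n + 1))
      (log (1 + (1 + z) ^ (1 / 2 : ℂ)) - log 2) := by
  refine hasSum_mul_pow_of_hasDerivAt
    (g := fun z => log (1 + (1 + z) ^ (1 / 2 : ℂ)) - log 2)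
    (g' := fun z => 1 / 2 * ((1 + z) ^ (1 / 2 : ℂ))⁻¹ / (1 + (1 + z) ^ (1 / 2 : ℂ)))
    (fun n => by omega) ?_ ?_ (by norm_num) (fun w hw => ?_) (fun w hw => ?_)
    (mem_closedBall_zero_iff.2 hz)
  · refine .of_nonneg_of_le (fun n => norm_nonneg _) (fun n => ?_)
      summable_scaledCentralBinom_div
    have h1 : ‖(2 * n + 2 : ℂ)‖ = 2 * n + 2 := by
      exact_mod_cast Complex.norm_natCast (2 * n + 2)
    rw [norm_div, norm_mul, norm_pow, norm_neg, norm_one, one_pow, one_mul, h1, norm_real,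
      Real.norm_of_nonneg (scaledCentralBinom_nonneg _), scaledCentralBinom_succ]
    gcongr
    refine mul_le_of_le_one_right (scaledCentralBinom_nonneg n)
      ((div_le_one₀ (by positivity)).2 (by linarith))
  · exact ((continuousOn_const.add continuousOn_one_add_cpow_half).clog
      fun w _ => .inl (re_one_add_cpow_half_pos _)).sub continuousOn_const
  · exact (((hasDerivAt_one_add_cpow_half (mem_ball_zero_iff.1 hw)).const_add 1).clog
      (.inl (re_one_add_cpow_half_pos _))).sub_const _
  · rw [mem_ball_zero_iff] at hw
    have hterm : ∀ n : ℕ, (-1) ^ n * (scaledCentralBinom (n + 1) : ℂ) / (2 * n + 2) *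
        ((n + 1 : ℕ) * w ^ (n + 1 - 1)) =
        (-1) ^ n * (scaledCentralBinom (n + 1) : ℂ) / 2 * w ^ n := fun n => by
      have h1 : (n + 1 : ℂ) ≠ 0 := by exact_mod_cast n.succ_ne_zero
      have h2 : (2 * n + 2 : ℂ) ≠ 0 := by
        rw [← mul_add_one]; exact mul_ne_zero two_ne_zero h1
      push_cast
      field_simp
    simp_rw [hterm]
    rcases eq_or_ne w 0 with rfl | hw0
    · convert hasSum_single (f := fun n : ℕ => (-1) ^ n * (scaledCentralBinom (n + 1) : ℂ) / 2 *
        (0 : ℂ) ^ n) 0 (fun n hn => by simp [hn]) using 1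
      simp [scaledCentralBinom, Nat.centralBinom]
      norm_num
    · have h := (hasSum_nat_add_iff' 1).2 (hasSum_one_add_cpow_neg_half hw)
      have h0 : scaledCentralBinom 0 = 1 := by simp [scaledCentralBinom]
      simp only [Finset.sum_range_one, h0, pow_zero, mul_one, ofReal_one] at h
      have hsq := one_add_cpow_half_sq w
      have h1 := one_add_cpow_half_ne_zero hw
      have h2 : 1 + (1 + w) ^ (1 / 2 : ℂ) ≠ 0 :=
        slitPlane_ne_zero (.inl (re_one_add_cpow_half_pos _))
      have hval : 1 / 2 * ((1 + w) ^ (1 / 2 : ℂ))⁻¹ / (1 + (1 + w) ^ (1 / 2 : ℂ)) =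
          -(1 / (2 * w)) * (((1 + w) ^ (1 / 2 : ℂ))⁻¹ - 1) := by
        generalize (1 + w) ^ (1 / 2 : ℂ) = s at hsq h1 h2 ⊢
        field_simp
        linear_combination -hsq
      rw [hval]
      refine (h.mul_left _).congr_fun fun n => ?_
      field_simp
      ring

theorem log_div_of_re_nonneg_of_re_pos {u v : ℂ} (hu : 0 ≤ u.re) (hu0 : u ≠ 0) (hv : 0 < v.re) :
    log (u / v) = log u - log v := by
  have hv0 : v ≠ 0 := slitPlane_ne_zero (.inl hv)
  have hau := abs_le.1 (abs_arg_le_pi_div_two_iff.2 hu)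
  have hav := abs_lt.1 (abs_arg_lt_pi_div_two_iff.2 (.inl hv))
  have hvpi : v.arg ≠ Real.pi := by linarith [Real.pi_pos]
  rw [div_eq_mul_inv, (log_mul_eq_add_log_iff hu0 (inv_ne_zero hv0)).2, log_inv _ hvpi,
    sub_eq_add_neg]
  rw [arg_inv, if_neg hvpi]
  constructor <;> linarith

theorem zigzagOddTerm_succ (θ : ℝ) (n : ℕ) :
    zigzagOddTerm θ (n + 1) = 1 / (I * θ) *
      ((-1) ^ n * (scaledCentralBinom n : ℂ) / (2 * n + 1) * exp (I * θ) ^ (2 * n + 1) -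
        (-1) ^ n * (scaledCentralBinom n : ℂ) / (2 * n + 1) * 1 ^ (2 * n + 1)) := by
  have hexp : exp (((2 * n + 1 : ℕ) : ℂ) * I * θ) = exp (I * θ) ^ (2 * n + 1) := by
    rw [← exp_nat_mul, mul_assoc]
  have h1 : (n.factorial : ℂ) ≠ 0 := by exact_mod_cast n.factorial_ne_zero
  have h2 : (2 * n + 1 : ℂ) ≠ 0 := by exact_mod_cast (2 * n).succ_ne_zero
  rw [zigzagOddTerm, show 2 * (n + 1) - 1 = 2 * n + 1 by omega,
    show 2 * (n + 1) - 2 = 2 * n by omega, Nat.add_sub_cancel, hexp,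
    scaledCentralBinom_eq_factorial]
  push_cast
  field_simp
  ring

theorem zigzagEvenTerm_succ (θ : ℝ) (n : ℕ) :
    zigzagEvenTerm θ (n + 1) = 1 / (I * θ) *
      ((-1) ^ n * (scaledCentralBinom (n + 1) : ℂ) / (2 * n + 2) * exp (-2 * I * θ) ^ (n + 1) -
        (-1) ^ n * (scaledCentralBinom (n + 1) : ℂ) / (2 * n + 2) * 1 ^ (n + 1)) := by
  have hexp : exp (-((2 * (n + 1) : ℕ) : ℂ) * I * θ) = exp (-2 * I * θ) ^ (n + 1) := by
    rw [← exp_nat_mul]; push_cast; ring_nf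
  have h1 : ((n + 1).factorial : ℂ) ≠ 0 := by exact_mod_cast (n + 1).factorial_ne_zero
  have h2 : (n + 1 : ℂ) ≠ 0 := by exact_mod_cast n.succ_ne_zero
  have h3 : (2 * n + 2 : ℂ) ≠ 0 := by rw [← mul_add_one]; exact mul_ne_zero two_ne_zero h2
  rw [zigzagEvenTerm, hexp, scaledCentralBinom_eq_factorial]
  push_cast
  field_simp
  ring

/-- For every real `θ` with `0 < |θ| < π`, both series
`S₁(θ) = ∑_{ℓ≥1} Z_∞^{2ℓ−1}·(e^{(2ℓ−1)iθ}−1)/((2ℓ−1)iθ)` and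
`S₂(θ) = ∑_{ℓ≥1} Z_∞^{2ℓ}·(e^{−2ℓiθ}−1)/(2ℓiθ)` converge absolutely, and
`S₁(θ) − S₂(θ) = (1/(iθ))·Log((e^{iθ} + √(1+e^{2iθ}))/(1 + √(1+e^{−2iθ})))`, where `Log`
and `√` denote the principal branches of the complex logarithm and square root.
(The sums over `ℓ ≥ 1` are written via the reindexing `ℓ = n + 1`.) -/
theorem zigzag_sigma_factor_closed_form (θ : ℝ) (h0 : 0 < |θ|) (hπ : |θ| < Real.pi) :
    Summable (fun n : ℕ => ‖zigzagOddTerm θ (n + 1)‖) ∧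
    Summable (fun n : ℕ => ‖zigzagEvenTerm θ (n + 1)‖) ∧
    ∃ S₁ S₂ : ℂ,
      HasSum (fun n : ℕ => zigzagOddTerm θ (n + 1)) S₁ ∧
      HasSum (fun n : ℕ => zigzagEvenTerm θ (n + 1)) S₂ ∧
      S₁ - S₂ = (1 / (Complex.I * θ)) *
        Complex.log ((Complex.exp (Complex.I * θ) +
            (1 + Complex.exp (2 * Complex.I * θ)) ^ ((1 : ℂ) / 2)) /
          (1 + (1 + Complex.exp (-2 * Complex.I * θ)) ^ ((1 : ℂ) / 2))) := by
  have hz : ‖exp (I * θ)‖ ≤ 1 := by rw [mul_comm, norm_exp_ofReal_mul_I]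
  have hw : ‖exp (-2 * I * θ)‖ ≤ 1 := by
    rw [show (-2 * I * θ : ℂ) = ((-2 * θ : ℝ) : ℂ) * I by push_cast; ring, norm_exp_ofReal_mul_I]
  have hz2 : exp (I * θ) ^ 2 = exp (2 * I * θ) := by rw [← exp_nat_mul, mul_assoc]; norm_num
  have hodd := ((hasSum_log_add_cpow_half hz).sub
    (hasSum_log_add_cpow_half norm_one.le)).mul_left (1 / (I * (θ : ℂ)))
  have heven := ((hasSum_log_one_add_cpow_half hw).sub
    (hasSum_log_one_add_cpow_half norm_one.le)).mul_left (1 / (I * (θ : ℂ)))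
  simp_rw [← zigzagOddTerm_succ] at hodd
  simp_rw [← zigzagEvenTerm_succ] at heven
  refine ⟨hodd.summable.norm, heven.summable.norm, _, _, hodd, heven, ?_⟩
  rw [← hz2, log_div_of_re_nonneg_of_re_pos (re_add_cpow_half_nonneg _) (add_cpow_half_ne_zero _)
    (re_one_add_cpow_half_pos _), one_pow]
  ring
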